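/- For all real x with |x| < 1 and every nonnegative integer j, the coefficient of x^j in the power series expansion of ((1+√(1+x))/2)^m, where m is a complex (or real) exponent not a nonnegative integer, equals (m/(m−j)) · C(m−j, j) / 4^j (generalized binomial coefficient). -/

import Mathlib

open Complex Metric

/-- The complex function `((1 + √(1 + z)) / 2) ^ m`, with principal branches. -/
noncomputable def halfOnePlusSqrtCpow (m z : ℂ) : ℂ :=
  ((1 + (1 + z) ^ (1 / 2 : ℂ)) / 2) ^ m

lemma one_add_mem_slitPlane_of_mem_ball {z : ℂ} (hz : z ∈ ball (0 : ℂ) 1) :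
    1 + z ∈ slitPlane := by
  rw [mem_ball_zero_iff] at hz
  exact mem_slitPlane_of_norm_lt_one hz

lemma re_cpow_half_pos {w : ℂ} (hw : w ∈ slitPlane) : 0 < (w ^ (1 / 2 : ℂ)).re := by
  have h0 : w ≠ 0 := slitPlane_ne_zero hw
  rw [cpow_def_of_ne_zero h0, exp_re]
  have him : (log w * (1 / 2)).im = arg w / 2 := by
    rw [show (1 / 2 : ℂ) = ((1 / 2 : ℝ) : ℂ) by push_cast; rfl, im_mul_ofReal, log_im]
    ring
  rw [him]
  have hpi : arg w ≠ Real.pi := (mem_slitPlane_iff_arg.mp hw).1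
  have h1 := neg_pi_lt_arg w
  have h2 := lt_of_le_of_ne (arg_le_pi w) hpi
  exact mul_pos (Real.exp_pos _) (Real.cos_pos_of_mem_Ioo ⟨by linarith, by linarith⟩)

lemma cpow_half_sq (w : ℂ) : (w ^ (1 / 2 : ℂ)) ^ 2 = w := by
  rw [one_div]
  exact_mod_cast cpow_nat_inv_pow w two_ne_zero

lemma hasDerivAt_cpow_half_one_add {z : ℂ} (hz : z ∈ ball (0 : ℂ) 1) :
    HasDerivAt (fun z : ℂ => (1 + z) ^ (1 / 2 : ℂ)) (1 / (2 * (1 + z) ^ (1 / 2 : ℂ))) z := by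
  have hs := one_add_mem_slitPlane_of_mem_ball hz
  have h := ((hasDerivAt_id' z).const_add 1).cpow_const (c := (1 / 2 : ℂ)) hs
  refine h.congr_deriv ?_
  have h0 : 1 + z ≠ 0 := slitPlane_ne_zero hs
  have hs0 : (1 + z) ^ (1 / 2 : ℂ) ≠ 0 := by simp [cpow_eq_zero_iff, h0]
  rw [cpow_sub _ _ h0, cpow_one]
  have hsq := cpow_half_sq (1 + z)
  generalize (1 + z) ^ (1 / 2 : ℂ) = s at *
  rw [← hsq]
  field_simp

lemma hasDerivAt_halfOnePlusSqrtCpow (m : ℂ) {z : ℂ} (hz : z ∈ ball (0 : ℂ) 1) :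
    HasDerivAt (halfOnePlusSqrtCpow m)
      (m * halfOnePlusSqrtCpow m z /
        (2 * ((1 + z) ^ (1 / 2 : ℂ) * (1 + (1 + z) ^ (1 / 2 : ℂ))))) z := by
  have hpos := re_cpow_half_pos (one_add_mem_slitPlane_of_mem_ball hz)
  have hre : 0 < ((1 + (1 + z) ^ (1 / 2 : ℂ)) / 2).re := by
    rw [div_ofNat_re, add_re, one_re]
    positivity
  have hslit : (1 + (1 + z) ^ (1 / 2 : ℂ)) / 2 ∈ slitPlane := Or.inl hre
  have h := (((hasDerivAt_cpow_half_one_add hz).const_add 1).div_const 2).cpow_const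
    (c := m) hslit
  refine h.congr_deriv ?_
  have hb0 := slitPlane_ne_zero hslit
  have hs0 : (1 + z) ^ (1 / 2 : ℂ) ≠ 0 := fun h => by rw [h] at hpos; exact hpos.false
  rw [cpow_sub _ _ hb0, cpow_one, halfOnePlusSqrtCpow]
  have h1 : 1 + (1 + z) ^ (1 / 2 : ℂ) ≠ 0 := fun h => hb0 (by rw [h, zero_div])
  generalize ((1 + (1 + z) ^ (1 / 2 : ℂ)) / 2) ^ m = f
  field_simp

lemma differentiableOn_halfOnePlusSqrtCpow (m : ℂ) :
    DifferentiableOn ℂ (halfOnePlusSqrtCpow m) (ball 0 1) := fun _ hz =>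
  (hasDerivAt_halfOnePlusSqrtCpow m hz).differentiableAt.differentiableWithinAt

lemma DifferentiableOn.iteratedDeriv_of_isOpen {f : ℂ → ℂ} {s : Set ℂ}
    (hf : DifferentiableOn ℂ f s) (hs : IsOpen s) (n : ℕ) :
    DifferentiableOn ℂ (iteratedDeriv n f) s := by
  induction n with
  | zero => simpa using hf
  | succ n ih => rw [iteratedDeriv_succ]; exact ih.deriv hs

lemma hasDerivAt_iteratedDeriv_halfOnePlusSqrtCpow (m : ℂ) (n : ℕ) {z : ℂ}
    (hz : z ∈ ball (0 : ℂ) 1) :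
    HasDerivAt (iteratedDeriv n (halfOnePlusSqrtCpow m))
      (iteratedDeriv (n + 1) (halfOnePlusSqrtCpow m) z) z := by
  rw [iteratedDeriv_succ]
  exact (((differentiableOn_halfOnePlusSqrtCpow m).iteratedDeriv_of_isOpen isOpen_ball
    n).differentiableAt (isOpen_ball.mem_nhds hz)).hasDerivAt

/-- The `n`-th derivative of the hypergeometric differential equation satisfied by
`halfOnePlusSqrtCpow m`. -/
lemma iteratedDeriv_halfOnePlusSqrtCpow_ode (m : ℂ) (n : ℕ) :
    ∀ z ∈ ball (0 : ℂ) 1,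
      4 * (z * (1 + z)) * iteratedDeriv (n + 2) (halfOnePlusSqrtCpow m) z
        + (4 * n * (1 + 2 * z) + (6 - 4 * m) * z - 4 * (m - 1))
          * iteratedDeriv (n + 1) (halfOnePlusSqrtCpow m) z
        + (m - 2 * n) * (m - 2 * n - 1) * iteratedDeriv n (halfOnePlusSqrtCpow m) z = 0 := by
  induction n with
  | zero =>
    intro z hz
    have hpos := re_cpow_half_pos (one_add_mem_slitPlane_of_mem_ball hz)
    have hs0 : (1 + z) ^ (1 / 2 : ℂ) ≠ 0 := fun h => by rw [h] at hpos; exact hpos.false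
    have hs1 : 1 + (1 + z) ^ (1 / 2 : ℂ) ≠ 0 := fun h => by
      have := congrArg re h
      rw [add_re, one_re, zero_re] at this
      linarith
    have hd := hasDerivAt_halfOnePlusSqrtCpow m hz
    have hs := hasDerivAt_cpow_half_one_add hz
    have hquot := (hd.const_mul m).div ((hs.mul (hs.const_add 1)).const_mul 2)
      (mul_ne_zero two_ne_zero (mul_ne_zero hs0 hs1))
    have hderiv : deriv (halfOnePlusSqrtCpow m) =ᶠ[nhds z] _ :=
      Filter.eventuallyEq_of_mem (isOpen_ball.mem_nhds hz)
        fun w hw => (hasDerivAt_halfOnePlusSqrtCpow m hw).deriv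
    have h2 := (hquot.congr_of_eventuallyEq hderiv).deriv
    have hsq := cpow_half_sq (1 + z)
    simp only [zero_add, iteratedDeriv_succ, iteratedDeriv_zero, Pi.mul_apply] at h2 ⊢
    rw [h2, hd.deriv]
    generalize halfOnePlusSqrtCpow m z = f at *
    generalize (1 + z) ^ (1 / 2 : ℂ) = s at *
    obtain rfl : z = s ^ 2 - 1 := by rw [hsq]; ring
    push_cast
    field_simp
    ring
  | succ n ih =>
    intro z hz
    have h0 := hasDerivAt_iteratedDeriv_halfOnePlusSqrtCpow m n hz
    have h1 := hasDerivAt_iteratedDeriv_halfOnePlusSqrtCpow m (n + 1) hz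
    have h2 := hasDerivAt_iteratedDeriv_halfOnePlusSqrtCpow m (n + 2) hz
    have hid := hasDerivAt_id' z
    have hA := ((hid.mul (hid.const_add 1)).const_mul 4).mul h2
    have hB := ((((hid.const_mul 2).const_add 1).const_mul (4 * (n : ℂ))).add
      (hid.const_mul (6 - 4 * m))).sub_const (4 * (m - 1)) |>.mul h1
    have hL := (hA.add hB).add (h0.const_mul ((m - 2 * n) * (m - 2 * n - 1)))
    have hzero := hL.unique ((hasDerivAt_const z (0 : ℂ)).congr_of_eventuallyEq
      (Filter.eventuallyEq_of_mem (isOpen_ball.mem_nhds hz) fun w hw => by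
        simpa using ih w hw))
    simp only [Pi.mul_apply, Pi.add_apply] at hzero
    push_cast
    linear_combination hzero

/-- Taylor coefficients of `halfOnePlusSqrtCpow m` at the origin. -/
lemma iteratedDeriv_halfOnePlusSqrtCpow_zero (m : ℂ) (hm : ∀ n : ℕ, m ≠ n) (n : ℕ) :
    iteratedDeriv n (halfOnePlusSqrtCpow m) 0 =
      m / (m - n) * (∏ i ∈ Finset.range n, (m - n - i)) / 4 ^ n := by
  induction n with
  | zero =>
    have h0 : m ≠ 0 := by simpa using hm 0
    norm_num [halfOnePlusSqrtCpow, h0]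
  | succ n ih =>
    have hode := iteratedDeriv_halfOnePlusSqrtCpow_ode m n 0 (mem_ball_self one_pos)
    rw [ih] at hode
    have hn : m - n ≠ 0 := sub_ne_zero.mpr (hm n)
    have hn1 : m - (n + 1) ≠ 0 := sub_ne_zero.mpr (by exact_mod_cast hm (n + 1))
    have hprod : (m - n) * ∏ i ∈ Finset.range (n + 1), (m - (n + 1 : ℕ) - i)
        = (m - 2 * n) * (m - 2 * n - 1) * ∏ i ∈ Finset.range n, (m - n - i) := by
      have hshift : (m - n) * ∏ i ∈ Finset.range (n + 1), (m - (n + 1 : ℕ) - i)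
          = ∏ i ∈ Finset.range (n + 2), (m - n - i) := by
        rw [Finset.prod_range_succ' _ (n + 1), mul_comm]
        congr 1
        · refine Finset.prod_congr rfl fun i _ => ?_
          push_cast
          ring
        · simp
      rw [hshift, Finset.prod_range_succ, Finset.prod_range_succ]
      push_cast
      ring
    have hcancel : 4 * (m - (n + 1)) * iteratedDeriv (n + 1) (halfOnePlusSqrtCpow m) 0
        = 4 * (m - (n + 1)) * (m / (m - (n + 1 : ℕ)) *
          (∏ i ∈ Finset.range (n + 1), (m - (n + 1 : ℕ) - i)) / 4 ^ (n + 1)) := by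
      have hprod' := (eq_div_iff hn).mpr ((mul_comm _ _).trans hprod)
      rw [hprod']
      push_cast
      field_simp at hode ⊢
      linear_combination -hode
    exact mul_left_cancel₀ (mul_ne_zero (by norm_num) hn1) hcancel

lemma halfOnePlusSqrtCpow_ofReal (m : ℝ) {x : ℝ} (hx : 0 ≤ 1 + x) :
    halfOnePlusSqrtCpow m x = (((1 + Real.sqrt (1 + x)) / 2) ^ m : ℝ) := by
  rw [halfOnePlusSqrtCpow, ofReal_cpow (by positivity), Real.sqrt_eq_rpow]
  push_cast [ofReal_cpow hx]
  rfl

theorem stmt_13 (m : ℝ) (hm : ∀ n : ℕ, m ≠ n) (x : ℝ) (hx : |x| < 1) :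
    ((1 + Real.sqrt (1 + x)) / 2) ^ m =
      ∑' j : ℕ, (m / (m - j)) *
        ((∏ i ∈ Finset.range j, (m - j - i)) / (j.factorial : ℝ)) * x ^ j / 4 ^ j := by
  have hball : (x : ℂ) ∈ ball (0 : ℂ) 1 := by simpa using hx
  have htaylor := hasSum_taylorSeries_on_ball (r := 1)
    (differentiableOn_halfOnePlusSqrtCpow m) hball
  rw [halfOnePlusSqrtCpow_ofReal m (by linarith [(abs_lt.mp hx).1])] at htaylor
  refine (HasSum.tsum_eq (hasSum_ofReal.mp ?_)).symm
  refine (congrArg (HasSum · _) (funext fun j => ?_)).mpr htaylor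
  rw [iteratedDeriv_halfOnePlusSqrtCpow_zero m (fun n => by exact_mod_cast hm n)]
  simp only [smul_eq_mul, sub_zero]
  push_cast
  ring
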